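/- arXiv:2012.14778 — 3 statements merged into one kernel-verified Lean document; each statement's English description precedes it below -/
import Mathlib

section
/- Let S be a positive semifield and (X, a, b) a δ-algebra. Then for all A, B ⊆ X and all λ ∈ S with λ ≠ 0: λ • b(A) = b({ λ • x | x ∈ A }) and b(A) + b(B) = b({ x + y | x ∈ A, y ∈ B }). -/
universe u

/-- The structure map of the free `S`-module (semimodule) monad on a left `S`-module `M`:
`a(φ) = Σ_{x ∈ supp φ} φ(x) • x`. -/
noncomputable def structMap (S : Type*) (M : Type*) [Semiring S] [AddCommMonoid M]
    [Module S M] (φ : M →₀ S) : M :=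
  φ.sum fun x s => s • x

/-- The convex closure of a subset `A` of a left `S`-module:
`conv(A) = { a(φ) | φ finitely supported, supp φ ⊆ A, Σ_x φ(x) = 1 }`. -/
def convClos (S : Type*) {M : Type*} [Semiring S] [AddCommMonoid M] [Module S M]
    (A : Set M) : Set M :=
  { m | ∃ φ : M →₀ S, ↑φ.support ⊆ A ∧ (φ.sum fun _ s => s) = 1 ∧ structMap S M φ = m }

/-- A subset of a left `S`-module is convex if it equals its convex closure. -/
def IsConvex (S : Type*) {M : Type*} [Semiring S] [AddCommMonoid M] [Module S M]
    (A : Set M) : Prop :=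
  convClos S A = A

/-- `c(Φ)`: the set of finitely supported functions of the form
`x ↦ Σ_{A ∈ supp Φ, u(A) = x} Φ(A)` for choice functions `u` with `u(A) ∈ A` on `supp Φ`. -/
noncomputable def choiceSet {S : Type*} {X : Type*} [Semiring S] (Φ : Set X →₀ S) :
    Set (X →₀ S) :=
  { φ | ∃ u : Set X → X, (∀ A ∈ Φ.support, u A ∈ A) ∧ φ = Finsupp.mapDomain u Φ }

/-- The canonical weak distributive law `δ_X(Φ) = conv(c(Φ))`,
the convex closure being taken in the module `X →₀ S`. -/
noncomputable def deltaLaw (S : Type*) {X : Type*} [Semiring S] (Φ : Set X →₀ S) :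
    Set (X →₀ S) :=
  convClos S (choiceSet Φ)

/-- `α_a(Φ) = { a(φ) | φ ∈ c(Φ) }`, where `a` is the structure map of the module `M`. -/
noncomputable def alphaMap (S : Type*) {M : Type*} [Semiring S] [AddCommMonoid M]
    [Module S M] (Φ : Set M →₀ S) : Set M :=
  structMap S M '' choiceSet Φ

/-- The Eilenberg–Moore style description of `δ_X(Φ)` via witnesses
`ψ` finitely supported on `{(A, x) | x ∈ A}` such that
`Φ(A) = Σ_{x ∈ A} ψ(A,x)` for all `A` and `φ(x) = Σ_{A ∋ x} ψ(A,x)` for all `x`. -/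
noncomputable def deltaEM (S : Type*) {X : Type*} [Semiring S] (Φ : Set X →₀ S) :
    Set (X →₀ S) :=
  { φ | ∃ ψ : (Set X × X) →₀ S,
      (∀ p ∈ ψ.support, p.2 ∈ p.1) ∧
      Finsupp.mapDomain Prod.fst ψ = Φ ∧
      Finsupp.mapDomain Prod.snd ψ = φ }

/-- The multiplication of the convex-powerset-of-semimodule monad:
`μ(𝒜) = ⋃_{Ω ∈ 𝒜} α(Ω)`. -/
noncomputable def muC (S : Type*) {M : Type*} [Semiring S] [AddCommMonoid M] [Module S M]
    (𝒜 : Set (Set M →₀ S)) : Set M :=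
  ⋃ Ω ∈ 𝒜, alphaMap S Ω

/-- The Kleisli extension `g♯` of `g : Y → C Z`:
`g♯(𝒜) = ⋃_{φ ∈ 𝒜} { Σ_{y ∈ supp φ} φ(y) • ψ_y | ψ_y ∈ g(y) }`. -/
noncomputable def kleisliExt {S : Type*} {Y Z : Type*} [Semiring S]
    (g : Y → Set (Z →₀ S)) (𝒜 : Set (Y →₀ S)) : Set (Z →₀ S) :=
  ⋃ φ ∈ 𝒜, { χ | ∃ ψ : Y → (Z →₀ S), (∀ y ∈ φ.support, ψ y ∈ g y) ∧
      χ = ∑ y ∈ φ.support, φ y • ψ y }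

theorem structMap_eq_linearCombination {S M : Type*} [Semiring S] [AddCommMonoid M] [Module S M]
    (φ : M →₀ S) : structMap S M φ = Finsupp.linearCombination S id φ := rfl

/-- Linear maps commute with convex closure. -/
theorem LinearMap.image_convClos {S M N : Type*} [Semiring S] [AddCommMonoid M] [AddCommMonoid N]
    [Module S M] [Module S N] (f : M →ₗ[S] N) (T : Set M) :
    f '' convClos S T = convClos S (f '' T) := by
  classical
  apply Set.Subset.antisymm
  · rintro _ ⟨_, ⟨φ, hT, hsum, rfl⟩, rfl⟩
    refine ⟨φ.mapDomain f, ?_, ?_, ?_⟩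
    · intro y hy
      obtain ⟨x, hx, rfl⟩ := Finset.mem_image.1 (Finsupp.mapDomain_support hy)
      exact ⟨x, hT hx, rfl⟩
    · rwa [Finsupp.sum_mapDomain_index (fun _ => rfl) (fun _ _ _ => rfl)]
    · rw [structMap, Finsupp.sum_mapDomain_index (by simp) (by simp [add_smul]), structMap,
        map_finsuppSum]
      simp
  · rintro _ ⟨φ, hT, hsum, rfl⟩
    have hex : ∀ y, ∃ x, y ∈ f '' T → x ∈ T ∧ f x = y := fun y => by
      by_cases hy : y ∈ f '' T
      · obtain ⟨x, hx⟩ := hy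
        exact ⟨x, fun _ => hx⟩
      · exact ⟨0, fun h => absurd h hy⟩
    choose g hg using hex
    refine ⟨_, ⟨φ.mapDomain g, ?_, ?_, rfl⟩, ?_⟩
    · intro x hx
      obtain ⟨y, hy, rfl⟩ := Finset.mem_image.1 (Finsupp.mapDomain_support hx)
      exact (hg y (hT hy)).1
    · rwa [Finsupp.sum_mapDomain_index (fun _ => rfl) (fun _ _ _ => rfl)]
    · rw [structMap, Finsupp.sum_mapDomain_index (by simp) (by simp [add_smul]), structMap,
        map_finsuppSum]
      refine Finsupp.sum_congr fun y hy => ?_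
      rw [map_smul, (hg y (hT hy)).2]

theorem structMap_image_deltaLaw {S M : Type*} [Semiring S] [AddCommMonoid M] [Module S M]
    (Φ : Set M →₀ S) :
    structMap S M '' deltaLaw S Φ = convClos S (alphaMap S Φ) :=
  (Finsupp.linearCombination S (id : M → M)).image_convClos (choiceSet Φ)

theorem alphaMap_single {S M : Type*} [Semiring S] [AddCommMonoid M] [Module S M]
    (A : Set M) {s : S} (hs : s ≠ 0) :
    alphaMap S (Finsupp.single A s) = (fun x => s • x) '' A := by
  ext z
  constructor
  · rintro ⟨_, ⟨u, hu, rfl⟩, rfl⟩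
    exact ⟨u A, hu A (by simp [hs]), by simp [structMap]⟩
  · rintro ⟨x, hx, rfl⟩
    refine ⟨_, ⟨fun _ => x, fun C hC => ?_, rfl⟩, by simp [structMap]⟩
    obtain rfl : C = A := by simpa using Finsupp.support_single_subset hC
    exact hx

theorem alphaMap_single_add_single {S M : Type*} [Semiring S] [Nontrivial S] [AddCommMonoid M]
    [Module S M] {A B : Set M} (hAB : A ≠ B) :
    alphaMap S (Finsupp.single A (1 : S) + Finsupp.single B 1) =
      { z | ∃ x ∈ A, ∃ y ∈ B, z = x + y } := by
  classical
  ext z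
  constructor
  · rintro ⟨_, ⟨u, hu, rfl⟩, rfl⟩
    refine ⟨u A, hu A ?_, u B, hu B ?_, ?_⟩
    · simp [hAB.symm]
    · simp [hAB]
    · simp [structMap_eq_linearCombination, Finsupp.mapDomain_add]
  · rintro ⟨x, hx, y, hy, rfl⟩
    refine ⟨_, ⟨fun C => if C = A then x else y, fun C hC => ?_, rfl⟩, ?_⟩
    · by_cases hCA : C = A
      · simpa [hCA] using hx
      · obtain rfl : C = B := by
          by_contra hCB
          simp [Ne.symm hCA, Ne.symm hCB] at hC
        simpa [hCA] using hy
    · simp [structMap_eq_linearCombination, Finsupp.mapDomain_add, hAB.symm]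

/-- A union-compatible operation `b` that agrees on `C` and on a superset `E`
takes the same value on every set in between. -/
theorem eq_of_subset_of_subset_of_sUnion {X : Type*} {b : Set X → X}
    (hb : ∀ 𝒰 : Set (Set X), b (b '' 𝒰) = b (⋃₀ 𝒰)) {C D E : Set X}
    (hCD : C ⊆ D) (hDE : D ⊆ E) (h : b C = b E) : b D = b C := by
  have hpair : ∀ P Q : Set X, b {b P, b Q} = b (P ∪ Q) := fun P Q => by
    rw [← Set.image_pair, hb, Set.sUnion_pair]
  calc b D = b {b C, b D} := by rw [hpair, Set.union_eq_self_of_subset_left hCD]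
    _ = b {b E, b D} := by rw [h]
    _ = b C := by rw [hpair, Set.union_eq_self_of_subset_right hDE, h]

theorem smul_add_smul_mem_convClos {S M : Type*} [Semiring S] [AddCommMonoid M] [Module S M]
    {T : Set M} {x y : M} (hx : x ∈ T) (hy : y ∈ T) {s t : S} (hst : s + t = 1) :
    s • x + t • y ∈ convClos S T := by
  classical
  refine ⟨Finsupp.single x s + Finsupp.single y t, ?_, ?_, ?_⟩
  · intro z hz
    rcases Finset.mem_union.1 (Finsupp.support_add hz) with h | h
    · obtain rfl : z = x := by simpa using Finsupp.support_single_subset h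
      exact hx
    · obtain rfl : z = y := by simpa using Finsupp.support_single_subset h
      exact hy
  · rw [Finsupp.sum_add_index' (fun _ => rfl) (fun _ _ _ => rfl)]
    simpa using hst
  · simp [structMap_eq_linearCombination]

/-- in any `δ`-algebra `(X, a, b)` over a positive semifield, for all
`A, B ⊆ X` and `λ ≠ 0`: `λ • b(A) = b({ λ • x | x ∈ A })` and
`b(A) + b(B) = b({ x + y | x ∈ A, y ∈ B })`. -/
theorem deltaAlgebra_distributivity {S : Type*} [DivisionSemiring S]
    (hpos : ∀ a b : S, a + b = 0 → a = 0 ∧ b = 0)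
    {X : Type u} [AddCommMonoid X] [Module S X]
    (b : Set X → X)
    (hb1 : ∀ x : X, b {x} = x)
    (hb2 : ∀ 𝒰 : Set (Set X), b (b '' 𝒰) = b (⋃₀ 𝒰))
    (hb3 : ∀ Φ : Set X →₀ S,
        structMap S X (Finsupp.mapDomain b Φ) = b (structMap S X '' deltaLaw S Φ))
    (A B : Set X) (lam : S) (hlam : lam ≠ 0) :
    lam • b A = b ((fun x => lam • x) '' A) ∧
    b A + b B = b { z | ∃ x ∈ A, ∃ y ∈ B, z = x + y } := by
  have hconv : ∀ C : Set X, b C = b (convClos S C) := fun C => by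
    have h := hb3 (Finsupp.single C 1)
    rw [structMap_image_deltaLaw, alphaMap_single C one_ne_zero] at h
    simpa [structMap] using h
  have hα : ∀ Φ : Set X →₀ S, structMap S X (Finsupp.mapDomain b Φ) = b (alphaMap S Φ) :=
    fun Φ => by rw [hb3, structMap_image_deltaLaw, ← hconv]
  have hsmul : ∀ (s : S), s ≠ 0 → ∀ C : Set X, s • b C = b ((fun x => s • x) '' C) :=
    fun s hs C => by
      rw [← alphaMap_single C hs, ← hα]
      simp [structMap]
  refine ⟨hsmul lam hlam A, ?_⟩
  rcases eq_or_ne A B with rfl | hAB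
  · have h2 : (1 + 1 : S) ≠ 0 := fun h => one_ne_zero (hpos 1 1 h).1
    have hhalf : (1 + 1 : S)⁻¹ + (1 + 1 : S)⁻¹ = 1 := by
      rw [← mul_one (1 + 1 : S)⁻¹, ← mul_add, inv_mul_cancel₀ h2]
    have hdouble : b A + b A = b ((fun x => (1 + 1 : S) • x) '' A) := by
      rw [← hsmul _ h2, add_smul, one_smul]
    rw [hdouble]
    refine (eq_of_subset_of_subset_of_sUnion hb2 ?_ ?_ (hconv _)).symm
    · rintro _ ⟨x, hx, rfl⟩
      exact ⟨x, hx, x, hx, by simp [add_smul]⟩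
    · rintro _ ⟨x, hx, y, hy, rfl⟩
      have h := smul_add_smul_mem_convClos (Set.mem_image_of_mem (fun x => (1 + 1 : S) • x) hx)
        (Set.mem_image_of_mem (fun x => (1 + 1 : S) • x) hy) hhalf
      simpa only [smul_smul, inv_mul_cancel₀ h2, one_smul] using h
  · rw [← alphaMap_single_add_single (S := S) hAB, ← hα]
    simp [structMap_eq_linearCombination, Finsupp.mapDomain_add]
end

section
/- Let S be a positive semifield. Then (C, η, μ) is a monad on sets: (i) for every function f : X → Y and every convex 𝒜 ⊆ 𝕊X, the set C f(𝒜) = { 𝕊f(φ) | φ ∈ 𝒜 } is a convex subset of 𝕊Y; (ii) for every convex 𝒜 ⊆ 𝕊(C X), μ_X(𝒜) is a convex subset of 𝕊X; (iii) unit laws: μ_X({Δ_𝒜}) = 𝒜 for every 𝒜 ∈ C X, and μ_X({ 𝕊(η_X)(φ) | φ ∈ 𝒜 }) = 𝒜 for every 𝒜 ∈ C X, where η_X : X → C X sends x to {Δ_x}; (iv) associativity: for every convex 𝔄 ⊆ 𝕊(C(C X)), μ_X({ 𝕊(μ_X)(Ω) | Ω ∈ 𝔄 }) = μ_X(μ_{C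 X}(𝔄)). -/
universe u

section Convexity

variable {S : Type*} {M : Type*} [AddCommMonoid M] {ι : Type*}

section Semiring

variable [Semiring S] [Module S M]

theorem Finsupp.sum_single_smul (v : ι → M) (i : ι) (c : S) :
    ((Finsupp.single i c).sum fun i s => s • v i) = c • v i :=
  Finsupp.sum_single_index (zero_smul _ _)

theorem Finsupp.sum_mapDomain_smul {κ : Type*} (f : κ → ι) (v : ι → M) (φ : κ →₀ S) :
    ((Finsupp.mapDomain f φ).sum fun i s => s • v i) = φ.sum fun k s => s • v (f k) :=
  Finsupp.sum_mapDomain_index (fun _ => zero_smul _ _) (fun _ _ _ => add_smul _ _ _)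

theorem Finsupp.sum_finsetSum_smul {κ : Type*} (s : Finset κ) (φ : κ → ι →₀ S)
    (v : ι → M) :
    ((∑ k ∈ s, φ k).sum fun i c => c • v i) = ∑ k ∈ s, (φ k).sum fun i c => c • v i :=
  (Finsupp.sum_finsetSum_index (h := fun i c => c • v i) (fun _ => zero_smul _ _)
    (fun _ _ _ => add_smul _ _ _)).symm

theorem mem_alphaMap {Φ : Set M →₀ S} {m : M} :
    m ∈ alphaMap S Φ ↔
      ∃ v : Set M → M, (∀ A ∈ Φ.support, v A ∈ A) ∧ (Φ.sum fun A s => s • v A) = m := by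
  have key (v : Set M → M) :
      structMap S M (Finsupp.mapDomain v Φ) = Φ.sum fun A s => s • v A :=
    Finsupp.sum_mapDomain_smul v (fun x => x) Φ
  constructor
  · rintro ⟨_, ⟨v, hv, rfl⟩, rfl⟩
    exact ⟨v, hv, (key v).symm⟩
  · rintro ⟨v, hv, rfl⟩
    exact ⟨_, ⟨v, hv, rfl⟩, key v⟩

theorem mem_muC {𝒜 : Set (Set M →₀ S)} {m : M} :
    m ∈ muC S 𝒜 ↔ ∃ Ω ∈ 𝒜, m ∈ alphaMap S Ω := by
  simp [muC]

theorem subset_convClos (A : Set M) : A ⊆ convClos S A := by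
  intro a ha
  refine ⟨Finsupp.single a 1, ?_, ?_, ?_⟩
  · intro x hx
    have := Finsupp.support_single_subset hx
    rw [Finset.mem_singleton] at this
    exact this ▸ ha
  · exact Finsupp.sum_single_index rfl
  · rw [structMap, Finsupp.sum_single_smul (fun x => x), one_smul]

theorem isConvex_of_forall {A : Set M}
    (h : ∀ φ : M →₀ S, (∀ x ∈ φ.support, x ∈ A) → ∑ x ∈ φ.support, φ x = 1 →
      ∑ x ∈ φ.support, φ x • x ∈ A) : IsConvex S A := by
  refine Set.Subset.antisymm ?_ (subset_convClos A)
  rintro _ ⟨φ, hA, h1, rfl⟩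
  exact h φ hA h1

theorem IsConvex.sum_mem {A : Set M} (hA : IsConvex S A) {s : Finset ι} {w : ι → S}
    {z : ι → M} (hz : ∀ i ∈ s, z i ∈ A) (hw : ∑ i ∈ s, w i = 1) :
    ∑ i ∈ s, w i • z i ∈ A := by
  classical
  rw [← hA.subset.antisymm (subset_convClos A)]
  refine ⟨∑ i ∈ s, Finsupp.single (z i) (w i), ?_, ?_, ?_⟩
  · intro x hx
    obtain ⟨i, hi, hxi⟩ := Finset.mem_biUnion.1 (Finsupp.support_finsetSum hx)
    have := Finsupp.support_single_subset hxi
    rw [Finset.mem_singleton] at this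
    exact this ▸ hz i hi
  · rw [← Finsupp.sum_finsetSum_index (fun _ => rfl) (fun _ _ _ => rfl), ← hw]
    exact Finset.sum_congr rfl fun i _ => Finsupp.sum_single_index rfl
  · rw [structMap, Finsupp.sum_finsetSum_smul _ _ fun x => x]
    exact Finset.sum_congr rfl fun i _ => Finsupp.sum_single_smul _ _ _

theorem IsConvex.image {N : Type*} [AddCommMonoid N] [Module S N] {A : Set M}
    (hA : IsConvex S A) (f : M →ₗ[S] N) : IsConvex S (f '' A) := by
  refine isConvex_of_forall fun φ hφ h1 => ?_
  choose! g hg hfg using hφ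
  refine ⟨∑ x ∈ φ.support, φ x • g x, hA.sum_mem hg h1, ?_⟩
  rw [map_sum]
  exact Finset.sum_congr rfl fun x hx => by rw [map_smul, hfg x hx]

theorem muC_singleton_single [Nontrivial S] (A : Set M) :
    muC S ({Finsupp.single A (1 : S)} : Set (Set M →₀ S)) = A := by
  ext m
  simp only [mem_muC, Set.mem_singleton_iff, exists_eq_left, mem_alphaMap,
    Finsupp.support_single A (one_ne_zero : (1 : S) ≠ 0), Finset.mem_singleton,
    forall_eq]
  constructor
  · rintro ⟨v, hv, rfl⟩
    rwa [Finsupp.sum_single_smul, one_smul]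
  · intro hm
    exact ⟨fun _ => m, hm, by rw [Finsupp.sum_single_smul fun _ => m, one_smul]⟩

theorem alphaMap_mapDomain_singleton [Nontrivial S] {f : ι → M} (hf : Function.Injective f)
    (φ : ι →₀ S) :
    alphaMap S (Finsupp.mapDomain (fun i => ({f i} : Set M)) φ)
      = {φ.sum fun i s => s • f i} := by
  classical
  have hinj : Function.Injective fun i => ({f i} : Set M) :=
    Set.singleton_injective.comp hf
  ext m
  simp only [mem_alphaMap, Finsupp.sum_mapDomain_smul, Finsupp.mapDomain_support_of_injective hinj,
    Finset.forall_mem_image, Set.mem_singleton_iff]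
  constructor
  · rintro ⟨v, hv, rfl⟩
    exact Finset.sum_congr rfl fun i hi => congrArg _ (hv hi)
  · rintro rfl
    have hex (A : Set M) : ∃ x, ∀ y, A = {y} → x = y := by
      by_cases h : ∃ y, A = {y}
      · obtain ⟨y, rfl⟩ := h
        exact ⟨y, fun z hz => Set.singleton_injective hz⟩
      · exact ⟨0, fun y hy => (h ⟨y, hy⟩).elim⟩
    choose v hv using hex
    exact ⟨v, fun i _ => hv _ _ rfl, Finset.sum_congr rfl fun i _ => congrArg _ (hv _ _ rfl)⟩

end Semiring

section DivisionSemiring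

variable [DivisionSemiring S] [Module S M]

theorem eq_zero_of_sum_eq_zero_of_pos (hpos : ∀ a b : S, a + b = 0 → a = 0 ∧ b = 0)
    {s : Finset ι} {w : ι → S} (h : ∑ i ∈ s, w i = 0) {i : ι} (hi : i ∈ s) : w i = 0 := by
  classical
  rw [← Finset.add_sum_erase s w hi] at h
  exact (hpos _ _ h).1

theorem IsConvex.exists_smul_eq_sum (hpos : ∀ a b : S, a + b = 0 → a = 0 ∧ b = 0)
    {A : Set M} {s : Finset ι} {w : ι → S} {z : ι → M} (hA : s.Nonempty → IsConvex S A)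
    (hz : ∀ i ∈ s, z i ∈ A) :
    ∃ a, (∑ i ∈ s, w i ≠ 0 → a ∈ A) ∧ (∑ i ∈ s, w i) • a = ∑ i ∈ s, w i • z i := by
  by_cases h0 : ∑ i ∈ s, w i = 0
  · refine ⟨0, fun h => (h h0).elim, ?_⟩
    rw [smul_zero]
    refine (Finset.sum_eq_zero fun i hi => ?_).symm
    rw [eq_zero_of_sum_eq_zero_of_pos hpos h0 hi, zero_smul]
  · refine ⟨∑ i ∈ s, ((∑ j ∈ s, w j)⁻¹ * w i) • z i, fun _ => ?_, ?_⟩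
    · refine (hA (Finset.nonempty_of_sum_ne_zero h0)).sum_mem hz ?_
      rw [← Finset.mul_sum, inv_mul_cancel₀ h0]
    · rw [Finset.smul_sum]
      exact Finset.sum_congr rfl fun i _ => by
        rw [smul_smul, ← mul_assoc, mul_inv_cancel₀ h0, one_mul]

theorem sum_smul_mem_alphaMap_sum_single (hpos : ∀ a b : S, a + b = 0 → a = 0 ∧ b = 0)
    {s : Finset ι} {w : ι → S} {B : ι → Set M} {z : ι → M}
    (hB : ∀ i ∈ s, IsConvex S (B i)) (hz : ∀ i ∈ s, z i ∈ B i) :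
    ∑ i ∈ s, w i • z i ∈ alphaMap S (∑ i ∈ s, Finsupp.single (B i) (w i)) := by
  classical
  set Φ : Set M →₀ S := ∑ i ∈ s, Finsupp.single (B i) (w i) with hΦ
  have hΦA (A : Set M) : Φ A = ∑ i ∈ s with B i = A, w i := by
    rw [hΦ, Finsupp.finsetSum_apply, Finset.sum_filter]
    exact Finset.sum_congr rfl fun i _ => Finsupp.single_apply
  have hex (A : Set M) :
      ∃ a, (Φ A ≠ 0 → a ∈ A) ∧ Φ A • a = ∑ i ∈ s with B i = A, w i • z i := by
    rw [hΦA]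
    refine IsConvex.exists_smul_eq_sum hpos ?_ fun i hi => ?_
    · rintro ⟨i, hi⟩
      rw [Finset.mem_filter] at hi
      exact hi.2 ▸ hB i hi.1
    · rw [Finset.mem_filter] at hi
      exact hi.2 ▸ hz i hi.1
  choose v hv hsum using hex
  refine mem_alphaMap.2 ⟨v, fun A hA => hv A (Finsupp.mem_support_iff.1 hA), ?_⟩
  have hsupp : Φ.support ⊆ s.image B := by
    intro A hA
    rw [Finsupp.mem_support_iff, hΦA] at hA
    obtain ⟨i, hi⟩ := Finset.nonempty_of_sum_ne_zero hA
    rw [Finset.mem_filter] at hi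
    exact Finset.mem_image.2 ⟨i, hi⟩
  rw [Finsupp.sum_of_support_subset _ hsupp (fun A c => c • v A) fun _ _ => zero_smul _ _,
    Finset.sum_congr rfl fun A _ => hsum A]
  exact Finset.sum_fiberwise_of_maps_to (fun i hi => Finset.mem_image_of_mem B hi) _

theorem sum_smul_mem_alphaMap_sum_smul (hpos : ∀ a b : S, a + b = 0 → a = 0 ∧ b = 0)
    {s : Finset ι} {w : ι → S} {Ω : ι → Set M →₀ S} {m : ι → M}
    (hΩ : ∀ i ∈ s, ∀ A ∈ (Ω i).support, IsConvex S A)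
    (hm : ∀ i ∈ s, m i ∈ alphaMap S (Ω i)) :
    ∑ i ∈ s, w i • m i ∈ alphaMap S (∑ i ∈ s, w i • Ω i) := by
  simp only [mem_alphaMap] at hm
  choose! v hv hvm using hm
  have h := sum_smul_mem_alphaMap_sum_single hpos
    (s := s.sigma fun i => (Ω i).support) (w := fun p => w p.1 * Ω p.1 p.2)
    (B := fun p => p.2) (z := fun p => v p.1 p.2)
    (fun p hp => hΩ p.1 (Finset.mem_sigma.1 hp).1 p.2 (Finset.mem_sigma.1 hp).2)
    (fun p hp => hv p.1 (Finset.mem_sigma.1 hp).1 p.2 (Finset.mem_sigma.1 hp).2)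
  rw [Finset.sum_sigma, Finset.sum_sigma] at h
  have hsum : ∑ i ∈ s, w i • m i
      = ∑ i ∈ s, ∑ A ∈ (Ω i).support, (w i * Ω i A) • v i A := by
    refine Finset.sum_congr rfl fun i hi => ?_
    conv_lhs => rw [← hvm i hi, Finsupp.sum, Finset.smul_sum]
    exact Finset.sum_congr rfl fun A _ => smul_smul _ _ _
  have hcomb : ∑ i ∈ s, w i • Ω i
      = ∑ i ∈ s, ∑ A ∈ (Ω i).support, Finsupp.single A (w i * Ω i A) := by
    refine Finset.sum_congr rfl fun i _ => ?_
    conv_lhs => rw [← Finsupp.sum_single (Ω i), Finsupp.sum, Finset.smul_sum]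
    exact Finset.sum_congr rfl fun A _ => by rw [Finsupp.smul_single, smul_eq_mul]
  rw [hsum, hcomb]
  exact h

theorem isConvex_muC (hpos : ∀ a b : S, a + b = 0 → a = 0 ∧ b = 0)
    {𝒜 : Set (Set M →₀ S)} (hsupp : ∀ Ω ∈ 𝒜, ∀ A ∈ Ω.support, IsConvex S A)
    (h𝒜 : IsConvex S 𝒜) : IsConvex S (muC S 𝒜) := by
  refine isConvex_of_forall fun φ hφ h1 => ?_
  simp only [mem_muC] at hφ
  choose! Ω hΩ hα using hφ
  exact mem_muC.2 ⟨_, h𝒜.sum_mem hΩ h1,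
    sum_smul_mem_alphaMap_sum_smul hpos (fun x hx => hsupp _ (hΩ x hx)) hα⟩

theorem muC_image_mapDomain_muC (hpos : ∀ a b : S, a + b = 0 → a = 0 ∧ b = 0)
    {𝔄 : Set (Set (Set M →₀ S) →₀ S)}
    (h𝔄 : ∀ Φ ∈ 𝔄, ∀ 𝒜 ∈ Φ.support,
      IsConvex S 𝒜 ∧ ∀ Θ ∈ 𝒜, ∀ A ∈ Θ.support, IsConvex S A) :
    muC S (Finsupp.mapDomain (muC S (M := M)) '' 𝔄) = muC S (muC S 𝔄) := by
  classical
  ext m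
  constructor
  · intro h
    obtain ⟨_, ⟨Φ, hΦ, rfl⟩, h⟩ := mem_muC.1 h
    obtain ⟨v, hv, rfl⟩ := mem_alphaMap.1 h
    have hmem : ∀ 𝒜 ∈ Φ.support, ∃ Θ ∈ 𝒜, v (muC S 𝒜) ∈ alphaMap S Θ := by
      intro 𝒜 h𝒜
      refine mem_muC.1 (hv _ ?_)
      rw [Finsupp.mem_support_iff] at h𝒜 ⊢
      intro h0
      rw [Finsupp.mapDomain, Finsupp.sum, Finsupp.finsetSum_apply] at h0
      have := eq_zero_of_sum_eq_zero_of_pos hpos h0 (Finsupp.mem_support_iff.2 h𝒜)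
      rw [Finsupp.single_eq_same] at this
      exact h𝒜 this
    choose! Θ hΘ hα using hmem
    rw [Finsupp.sum_mapDomain_smul]
    refine mem_muC.2 ⟨_, mem_muC.2 ⟨Φ, hΦ, mem_alphaMap.2 ⟨Θ, hΘ, rfl⟩⟩, ?_⟩
    exact sum_smul_mem_alphaMap_sum_smul hpos
      (fun 𝒜 h𝒜 => (h𝔄 Φ hΦ 𝒜 h𝒜).2 _ (hΘ 𝒜 h𝒜)) hα
  · intro h
    obtain ⟨_, hΩ, h⟩ := mem_muC.1 h
    obtain ⟨Φ, hΦ, hΩ⟩ := mem_muC.1 hΩ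
    obtain ⟨Θ, hΘ, rfl⟩ := mem_alphaMap.1 hΩ
    obtain ⟨v, hv, rfl⟩ := mem_alphaMap.1 h
    refine mem_muC.2 ⟨_, ⟨Φ, hΦ, rfl⟩, ?_⟩
    have hsum : ((Φ.sum fun 𝒜 s => s • Θ 𝒜).sum fun A s => s • v A)
        = ∑ 𝒜 ∈ Φ.support, Φ 𝒜 • (Θ 𝒜).sum fun A s => s • v A := by
      refine (Finsupp.sum_finsetSum_smul _ _ v).trans ?_
      refine Finset.sum_congr rfl fun 𝒜 _ => ?_
      refine (Finsupp.sum_smul_index (h := fun A s => s • v A)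
        fun _ => zero_smul _ _).trans ?_
      rw [Finsupp.smul_sum]
      exact Finset.sum_congr rfl fun A _ => (smul_smul _ _ _).symm
    rw [hsum]
    refine sum_smul_mem_alphaMap_sum_single hpos
      (fun 𝒜 h𝒜 => isConvex_muC hpos (h𝔄 Φ hΦ 𝒜 h𝒜).2 (h𝔄 Φ hΦ 𝒜 h𝒜).1)
      (fun 𝒜 h𝒜 => mem_muC.2 ⟨Θ 𝒜, hΘ 𝒜 h𝒜, mem_alphaMap.2 ⟨v, fun A hA => hv A ?_, rfl⟩⟩)
    rw [Finsupp.mem_support_iff] at hA ⊢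
    intro h0
    rw [Finsupp.sum, Finsupp.finsetSum_apply] at h0
    have := eq_zero_of_sum_eq_zero_of_pos hpos h0 h𝒜
    rw [Finsupp.smul_apply, smul_eq_mul] at this
    exact (mul_ne_zero (Finsupp.mem_support_iff.1 h𝒜) hA) this

end DivisionSemiring

end Convexity

/-- `(C, η, μ)` is a monad on sets, where `C X` is the set of convex
subsets of the module `X →₀ S` (convex subsets of `𝕊(C X)` are represented as convex
sets of finitely supported functions on `𝒫(𝕊X)` whose supports consist of convex sets):
(i) functoriality preserves convexity, (ii) `μ` preserves convexity,
(iii) the two unit laws, (iv) associativity. -/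
theorem convPow_monad (S : Type*) [DivisionSemiring S]
    (hpos : ∀ a b : S, a + b = 0 → a = 0 ∧ b = 0) :
    -- (i)
    (∀ (X Y : Type u) (f : X → Y) (𝒜 : Set (X →₀ S)), IsConvex S 𝒜 →
        IsConvex S (Finsupp.mapDomain f '' 𝒜)) ∧
    -- (ii)
    (∀ (X : Type u) (𝒜 : Set (Set (X →₀ S) →₀ S)),
        (∀ Ω ∈ 𝒜, ∀ A ∈ Ω.support, IsConvex S A) → IsConvex S 𝒜 →
        IsConvex S (muC S 𝒜)) ∧
    -- (iii) unit laws
    (∀ (X : Type u) (𝒜 : Set (X →₀ S)), IsConvex S 𝒜 →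
        muC S ({Finsupp.single 𝒜 (1 : S)} : Set (Set (X →₀ S) →₀ S)) = 𝒜 ∧
        muC S ((fun φ => Finsupp.mapDomain
            (fun x => ({Finsupp.single x (1 : S)} : Set (X →₀ S))) φ) '' 𝒜) = 𝒜) ∧
    -- (iv) associativity
    (∀ (X : Type u) (𝔄 : Set ((Set ((Set (X →₀ S)) →₀ S)) →₀ S)),
        (∀ Ω ∈ 𝔄, ∀ 𝒜 ∈ Ω.support,
            IsConvex S 𝒜 ∧ ∀ Θ ∈ 𝒜, ∀ A ∈ Θ.support, IsConvex S A) →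
        IsConvex S 𝔄 →
        muC S (Finsupp.mapDomain (muC S (M := X →₀ S)) '' 𝔄)
          = muC S (muC S 𝔄)) := by
  refine ⟨fun X Y f 𝒜 h𝒜 => h𝒜.image (Finsupp.lmapDomain S S f),
    fun X 𝒜 hsupp h𝒜 => isConvex_muC hpos hsupp h𝒜,
    fun X 𝒜 _ => ⟨muC_singleton_single 𝒜, ?_⟩,
    fun X 𝔄 h𝔄 _ => muC_image_mapDomain_muC hpos h𝔄⟩
  ext φ
  simp only [mem_muC, Set.exists_mem_image,
    alphaMap_mapDomain_singleton (Finsupp.single_left_injective (one_ne_zero : (1 : S) ≠ 0)),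
    Finsupp.smul_single, smul_eq_mul, mul_one, Finsupp.sum_single, Set.mem_singleton_iff,
    exists_eq_right']
end

section
/- Let S be a positive semifield and X a left S-module with structure map a : 𝕊X → X. Let Φ : 𝒫X → S be finitely supported with supp Φ = {A_1, …, A_n}, and suppose that for each i there is a finite B_i ⊆ A_i with A_i = conv(B_i), the sets B_1, …, B_n being pairwise distinct. Let Φ' : 𝒫X → S be the finitely supported function with Φ'(B_i) = Φ(A_i) for each i and Φ' zero on all other subsets. Then { a(φ) | φ ∈ c(Φ) } = conv({ a(ψ) | ψ ∈ c(Φ') }), the convex closure being taken in X. -/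
universe u

open scoped Pointwise

section ConvexClosure

variable {S M : Type*} [Semiring S] [AddCommMonoid M] [Module S M]

theorem sum_smul_mem_convClos {ι : Type*} {P : Set M} (t : Finset ι) (w : ι → S) (z : ι → M)
    (hz : ∀ i ∈ t, z i ∈ P) (hw : ∑ i ∈ t, w i = 1) :
    ∑ i ∈ t, w i • z i ∈ convClos S P := by
  classical
  refine ⟨∑ i ∈ t, Finsupp.single (z i) (w i), ?_, ?_, ?_⟩
  · intro x hx
    obtain ⟨i, hi, hxi⟩ := Finset.mem_biUnion.1 (Finsupp.support_finsetSum hx)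
    rw [Finset.mem_singleton.1 (Finsupp.support_single_subset hxi)]
    exact hz i hi
  · rw [← Finsupp.sum_finsetSum_index (fun _ => rfl) (fun _ _ _ => rfl), ← hw]
    exact Finset.sum_congr rfl fun i _ => Finsupp.sum_single_index rfl
  · rw [structMap, ← Finsupp.sum_finsetSum_index (fun x => zero_smul S x)
      (fun x a b => add_smul a b x)]
    exact Finset.sum_congr rfl fun i _ => Finsupp.sum_single_index (zero_smul _ _)

theorem convClos_zero : convClos S (0 : Set M) = 0 := by
  ext m
  constructor
  · rintro ⟨φ, hφ, -, rfl⟩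
    exact Finset.sum_eq_zero fun x hx => by
      simp [Set.mem_zero.1 (hφ hx)]
  · rintro rfl
    simpa using sum_smul_mem_convClos (P := (0 : Set M)) {()} (fun _ => (1 : S)) (fun _ => 0)

theorem convClos_add (P Q : Set M) :
    convClos S (P + Q) = convClos S P + convClos S Q := by
  ext m
  constructor
  · rintro ⟨φ, hφ, h1, rfl⟩
    choose! p hp q hq hpq using fun x (hx : x ∈ φ.support) => Set.mem_add.1 (hφ hx)
    refine Set.mem_add.2 ⟨_, sum_smul_mem_convClos φ.support φ p hp h1, _,
      sum_smul_mem_convClos φ.support φ q hq h1, ?_⟩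
    rw [← Finset.sum_add_distrib]
    exact Finset.sum_congr rfl fun x hx => by rw [← smul_add, hpq x hx]
  · rintro ⟨_, ⟨f, hf, hf1, rfl⟩, _, ⟨g, hg, hg1, rfl⟩, rfl⟩
    rw [Finsupp.sum] at hf1 hg1
    have key := sum_smul_mem_convClos (P := P + Q) (f.support ×ˢ g.support)
      (fun x => f x.1 * g x.2) (fun x => x.1 + x.2)
      (fun x hx => Set.add_mem_add (hf (Finset.mem_product.1 hx).1)
        (hg (Finset.mem_product.1 hx).2))
      (by simp_rw [Finset.sum_product, ← Finset.mul_sum, hg1, mul_one, hf1])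
    convert key using 1
    simp_rw [smul_add, Finset.sum_add_distrib]
    congr 1
    · simp_rw [Finset.sum_product, ← Finset.sum_smul, ← Finset.mul_sum, hg1, mul_one]
      rfl
    · simp_rw [Finset.sum_product_right, ← Finset.sum_smul, ← Finset.sum_mul, hf1, one_mul]
      rfl

theorem image_structMap_choiceSet (Φ : Set M →₀ S) :
    structMap S M '' choiceSet Φ = ∑ A ∈ Φ.support, Φ A • A := by
  have structMap_mapDomain (u : Set M → M) :
      structMap S M (Finsupp.mapDomain u Φ) = ∑ A ∈ Φ.support, Φ A • u A :=
    Finsupp.sum_mapDomain_index (fun _ => zero_smul _ _) (fun _ _ _ => add_smul _ _ _)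
  ext m
  rw [Set.mem_finsetSum]
  constructor
  · rintro ⟨_, ⟨u, hu, rfl⟩, rfl⟩
    exact ⟨fun A => Φ A • u A, fun hA => Set.smul_mem_smul_set (hu _ hA),
      (structMap_mapDomain u).symm⟩
  · rintro ⟨g, hg, rfl⟩
    choose! u hu hug using fun A (hA : A ∈ Φ.support) => Set.mem_smul_set.1 (hg hA)
    exact ⟨_, ⟨u, hu, rfl⟩, (structMap_mapDomain u).trans (Finset.sum_congr rfl hug)⟩

end ConvexClosure

section DivisionSemiring

variable {S M : Type*} [DivisionSemiring S] [AddCommMonoid M] [Module S M]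

theorem convClos_smul {s : S} (hs : s ≠ 0) (P : Set M) :
    convClos S (s • P) = s • convClos S P := by
  ext m
  constructor
  · rintro ⟨φ, hφ, h1, rfl⟩
    choose! p hp hsp using fun x (hx : x ∈ φ.support) => Set.mem_smul_set.1 (hφ hx)
    refine Set.mem_smul_set.2 ⟨_, sum_smul_mem_convClos φ.support (fun x => s⁻¹ * φ x * s) p hp
      ?_, ?_⟩
    · rw [Finsupp.sum] at h1
      rw [← Finset.sum_mul, ← Finset.mul_sum, h1, mul_one, inv_mul_cancel₀ hs]
    · rw [Finset.smul_sum]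
      exact Finset.sum_congr rfl fun x hx => by
        rw [smul_smul, mul_assoc, mul_inv_cancel_left₀ hs, mul_smul, hsp x hx]
  · rintro ⟨_, ⟨φ, hφ, h1, rfl⟩, rfl⟩
    rw [Finsupp.sum] at h1
    have key := sum_smul_mem_convClos (P := s • P) φ.support (fun x => s * φ x * s⁻¹)
      (fun x => s • x) (fun x hx => Set.smul_mem_smul_set (hφ hx))
      (by rw [← Finset.sum_mul, ← Finset.mul_sum, h1, mul_one, mul_inv_cancel₀ hs])
    convert key using 1
    simp_rw [smul_smul, inv_mul_cancel_right₀ hs, mul_smul, ← Finset.smul_sum]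
    rfl

theorem convClos_sum_smul {ι : Type*} (t : Finset ι) (s : ι → S) (P : ι → Set M)
    (hs : ∀ i ∈ t, s i ≠ 0) :
    convClos S (∑ i ∈ t, s i • P i) = ∑ i ∈ t, s i • convClos S (P i) := by
  classical
  induction t using Finset.induction_on with
  | empty => simpa using convClos_zero
  | insert i t hi ih =>
    rw [Finset.sum_insert hi, Finset.sum_insert hi, convClos_add,
      convClos_smul (hs i (Finset.mem_insert_self i t)),
      ih fun j hj => hs j (Finset.mem_insert_of_mem hj)]

end DivisionSemiring

/-- if every `A ∈ supp Φ` is the convex closure of a finite `B A ⊆ A`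
(the sets `B A` being pairwise distinct), and `Φ'` is supported on the `B A`'s with
`Φ'(B A) = Φ(A)`, then `{ a(φ) | φ ∈ c(Φ) } = conv({ a(ψ) | ψ ∈ c(Φ') })`. -/
theorem image_choiceSet_eq_convClos_of_finitely_generated {S : Type*} [DivisionSemiring S]
    (hpos : ∀ a b : S, a + b = 0 → a = 0 ∧ b = 0)
    {X : Type u} [AddCommMonoid X] [Module S X]
    (Φ Φ' : Set X →₀ S) (B : Set X → Set X)
    (hBfin : ∀ A ∈ Φ.support, (B A).Finite)
    (hBsub : ∀ A ∈ Φ.support, B A ⊆ A)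
    (hBgen : ∀ A ∈ Φ.support, convClos S (B A) = A)
    (hBinj : ∀ A ∈ Φ.support, ∀ A' ∈ Φ.support, B A = B A' → A = A')
    (hΦ'1 : ∀ A ∈ Φ.support, Φ' (B A) = Φ A)
    (hΦ'0 : ∀ C : Set X, (∀ A ∈ Φ.support, C ≠ B A) → Φ' C = 0) :
    structMap S X '' choiceSet Φ = convClos S (structMap S X '' choiceSet Φ') := by
  classical
  have hsupp : Φ'.support = Φ.support.image B := by
    ext C
    rw [Finset.mem_image]
    constructor
    · intro hC
      by_contra! h
      exact Finsupp.mem_support_iff.1 hC (hΦ'0 C fun A hA => (h A hA).symm)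
    · rintro ⟨A, hA, rfl⟩
      rw [Finsupp.mem_support_iff, hΦ'1 A hA]
      exact Finsupp.mem_support_iff.1 hA
  rw [image_structMap_choiceSet, image_structMap_choiceSet, hsupp,
    Finset.sum_image fun A hA A' hA' => hBinj A hA A' hA',
    convClos_sum_smul _ _ _ fun A hA => by
      rw [hΦ'1 A hA]; exact Finsupp.mem_support_iff.1 hA]
  exact Finset.sum_congr rfl fun A hA => by rw [hBgen A hA, hΦ'1 A hA]
end
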